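/- Let n ≥ 4 be even, let nᵢ = (cos(2πi/n), sin(2πi/n)) for i = 1,…,n, and let αᵢ = 1/n. Then the inradius of the compatible region m = {2·Σᵢ qᵢ αᵢ nᵢ : 0 ≤ qᵢ ≤ 1, Σᵢ qᵢ αᵢ = 1/2} ⊆ ℝ² equals (2/n)·cot(π/n): the closed ball of this radius centered at the origin is contained in m, and no closed ball of larger radius centered at the origin is contained in m. -/

import Mathlib

open Real

/-- The compatible region of a `k`-outcome POVM with rank-one effect directions
`n i` and weights `α i`. -/
def compatRegion {d k : ℕ} (α : Fin k → ℝ) (n : Fin k → EuclideanSpace ℝ (Fin d)) :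
    Set (EuclideanSpace ℝ (Fin d)) :=
  {x | ∃ q : Fin k → ℝ, (∀ i, 0 ≤ q i ∧ q i ≤ 1) ∧
    (∑ i, q i * α i = 1 / 2) ∧ x = ∑ i, (2 * (q i * α i)) • n i}

/-- The rotationally symmetric configuration `nᵢ = (cos(2πi/n), sin(2πi/n))` in `ℝ²`. -/
noncomputable def rotVec (n : ℕ) : Fin n → EuclideanSpace ℝ (Fin 2) := fun i =>
  (WithLp.equiv 2 (Fin 2 → ℝ)).symm
    ![Real.cos (2 * π * (i.1 + 1) / n), Real.sin (2 * π * (i.1 + 1) / n)]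

lemma aux_dirichlet (δ a : ℝ) (m : ℕ) :
    2 * sin δ * ∑ j ∈ Finset.range m, cos (a + 2 * δ * j)
      = sin (a - δ + 2 * δ * m) - sin (a - δ) := by
  induction m with
  | zero => simp
  | succ m ih =>
    rw [Finset.sum_range_succ, mul_add, ih]
    have h1 : a - δ + 2 * δ * ((m + 1 : ℕ) : ℝ) = (a + 2 * δ * m) + δ := by push_cast; ring
    have h2 : a - δ + 2 * δ * (m : ℝ) = (a + 2 * δ * m) - δ := by ring
    rw [h1, h2, sin_add, sin_sub]
    ring

lemma aux_sum (δ a : ℝ) (N : ℕ) (h : 2 * δ * N = π) (hs : 0 < sin δ) :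
    ∑ j ∈ Finset.range N, cos (a + 2 * δ * j) = - sin (a - δ) / sin δ := by
  have := aux_dirichlet δ a N
  rw [h, sin_add_pi] at this
  rw [eq_div_iff hs.ne']
  linarith

lemma aux_shift (f : ℕ → ℝ) (N : ℕ) (hf : ∀ i, f (i + N) = f i) (k : ℕ) :
    ∑ i ∈ Finset.range N, f (i + k) = ∑ i ∈ Finset.range N, f i := by
  induction k with
  | zero => simp
  | succ k ih =>
    rw [← ih]
    have h1 := Finset.sum_range_succ (fun i => f (i + k)) N
    have h2 := Finset.sum_range_succ' (fun i => f (i + k)) N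
    have h3 : f (N + k) = f (0 + k) := by rw [add_comm N k, hf, zero_add]
    have h4 : ∀ i, f (i + 1 + k) = f (i + (k + 1)) := fun i => by congr 1; ring
    simp only [h4] at h2
    linarith

lemma aux_choose (δ b : ℝ) (N : ℕ) (hN : 0 < N) (h : 2 * δ * N = π) (hδ : 0 < δ) (hδ2 : δ ≤ π) :
    ∃ k : ℕ, cos δ ≤ cos (b + 2 * δ * k) := by
  set k0 : ℤ := round (-b / (2 * δ)) with hk0
  have h1 : |b + 2 * δ * k0| ≤ δ := by
    have h2 := abs_sub_round (-b / (2 * δ))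
    have h3 : b + 2 * δ * k0 = -(2 * δ) * (-b / (2 * δ) - k0) := by field_simp; ring
    rw [h3, abs_mul, abs_neg, abs_of_pos (by positivity)]
    nlinarith
  have hmod : 0 ≤ k0 % (2 * N : ℤ) := Int.emod_nonneg _ (by positivity)
  refine ⟨(k0 % (2 * N : ℤ)).toNat, ?_⟩
  have h4 : (((k0 % (2 * N : ℤ)).toNat : ℕ) : ℝ) = (k0 : ℝ) - 2 * N * ((k0 / (2 * N : ℤ) : ℤ) : ℝ) := by
    have h5 : (((k0 % (2 * N : ℤ)).toNat : ℕ) : ℤ) = k0 - 2 * N * (k0 / (2 * N : ℤ)) := by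
      rw [Int.toNat_of_nonneg hmod, Int.emod_def]
    exact_mod_cast h5
  rw [h4]
  have h6 : b + 2 * δ * ((k0 : ℝ) - 2 * N * ((k0 / (2 * N : ℤ) : ℤ) : ℝ))
      = (b + 2 * δ * k0) - ((k0 / (2 * N : ℤ) : ℤ) : ℝ) * (2 * π) := by
    rw [← h]; ring
  rw [h6, cos_sub_int_mul_two_pi, ← cos_abs (b + 2 * δ * k0)]
  exact cos_le_cos_of_nonneg_of_le_pi (abs_nonneg _) hδ2 h1

lemma aux_abs_sum (δ c : ℝ) (N : ℕ) (hN : 0 < N) (h : 2 * δ * N = π) (hδ : 0 < δ) (hδ2 : δ ≤ π)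
    (hs : 0 < sin δ) :
    cos δ / sin δ ≤ ∑ i ∈ Finset.range N, |cos (c + 2 * δ * i)| := by
  obtain ⟨k, hk⟩ := aux_choose δ (c - δ + π / 2) N hN h hδ hδ2
  rw [← aux_shift (fun i : ℕ => |cos (c + 2 * δ * i)|) N _ k]
  · calc cos δ / sin δ ≤ cos (c - δ + π / 2 + 2 * δ * k) / sin δ := by gcongr
      _ = ∑ j ∈ Finset.range N, cos ((c + 2 * δ * k) + 2 * δ * j) := by
        rw [aux_sum δ _ N h hs, ← cos_add_pi_div_two]
        congr 2; ring
      _ ≤ _ := by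
        apply Finset.sum_le_sum
        intro i _
        refine le_trans (le_of_eq ?_) (le_abs_self _)
        congr 1; push_cast; ring
  · intro i
    have : c + 2 * δ * ((i + N : ℕ) : ℝ) = (c + 2 * δ * i) + π := by rw [← h]; push_cast; ring
    simp only [this, cos_add_pi, abs_neg]

lemma aux_convex {d k : ℕ} (α : Fin k → ℝ) (v : Fin k → EuclideanSpace ℝ (Fin d)) :
    Convex ℝ (compatRegion α v) := by
  rintro x ⟨q, hq, hs, rfl⟩ y ⟨p, hp, hs', rfl⟩ a b ha hb hab
  refine ⟨fun i => a * q i + b * p i, fun i => ⟨?_, ?_⟩, ?_, ?_⟩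
  · have := (hq i).1; have := (hp i).1; positivity
  · have := (hq i).2; have := (hp i).2; nlinarith
  · have : ∀ i, (a * q i + b * p i) * α i = a * (q i * α i) + b * (p i * α i) := fun i => by ring
    simp only [this, Finset.sum_add_distrib, ← Finset.mul_sum, hs, hs']
    rw [← add_mul, hab, one_mul]
  · rw [Finset.smul_sum, Finset.smul_sum, ← Finset.sum_add_distrib]
    refine Finset.sum_congr rfl fun i _ => ?_
    rw [smul_smul, smul_smul, ← add_smul]
    congr 1; ring

lemma aux_closed {d k : ℕ} (α : Fin k → ℝ) (v : Fin k → EuclideanSpace ℝ (Fin d)) :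
    IsClosed (compatRegion α v) := by
  have hc : IsCompact ((Set.univ.pi fun _ : Fin k => Set.Icc (0:ℝ) 1) ∩
      {q : Fin k → ℝ | ∑ i, q i * α i = 1 / 2}) := by
    apply IsCompact.inter_right
    · exact isCompact_univ_pi fun _ => isCompact_Icc
    · exact isClosed_eq (by fun_prop) (by fun_prop)
  have := (hc.image (f := fun q : Fin k → ℝ => ∑ i, (2 * (q i * α i)) • v i)
    (by fun_prop)).isClosed
  convert this using 1
  ext x
  constructor
  · rintro ⟨q, hq, hs, rfl⟩
    exact ⟨q, ⟨fun i _ => hq i, hs⟩, rfl⟩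
  · rintro ⟨q, ⟨hq, hs⟩, rfl⟩
    exact ⟨q, fun i => hq i trivial, hs, rfl⟩

lemma aux_double (f : ℕ → ℝ) (N : ℕ) :
    ∑ i : Fin (N + N), f i = ∑ i ∈ Finset.range N, (f i + f (N + i)) := by
  rw [Fin.sum_univ_eq_sum_range, Finset.sum_range_add, Finset.sum_add_distrib]

lemma aux_support (δ θ : ℝ) (N : ℕ) (hN : 0 < N) (h : 2 * δ * N = π) (hδ : 0 < δ) (hδ2 : δ ≤ π)
    (hs : 0 < sin δ) :
    ∃ q : Fin (N + N) → ℝ, (∀ i, 0 ≤ q i ∧ q i ≤ 1) ∧ ∑ i, q i = N ∧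
      cos δ / sin δ ≤ ∑ i, q i * cos (2 * δ * ((i : ℕ) + 1) - θ) := by
  set c : ℕ → ℝ := fun i => cos (2 * δ * (i + 1) - θ) with hc
  have hcN : ∀ i, c (N + i) = - c i := by
    intro i
    simp only [hc]
    rw [← cos_add_pi, ← h]
    congr 1; push_cast; ring
  set g : ℕ → ℝ := fun i => (1 + Real.sign (c i)) / 2 with hg
  have hcs : ∀ i, Real.sign (c i) * c i = |c i| := by
    intro i
    rcases lt_trichotomy (c i) 0 with h | h | h
    · rw [Real.sign_of_neg h, abs_of_neg h]; ring
    · simp [h]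
    · rw [Real.sign_of_pos h, abs_of_pos h]; ring
  refine ⟨fun i => g i, fun i => ?_, ?_, ?_⟩
  · simp only [hg]
    rcases Real.sign_apply_eq (c i) with h | h | h <;> rw [h] <;> norm_num
  · rw [aux_double]
    have : ∀ i, g i + g (N + i) = 1 := by
      intro i
      simp only [hg, hcN, Real.sign_neg]; ring
    simp [this]
  · have e := aux_double (fun i => g i * c i) N
    simp only [hc] at e ⊢
    rw [e]
    refine (aux_abs_sum δ (2 * δ - θ) N hN h hδ hδ2 hs).trans (Finset.sum_le_sum fun i _ => ?_)
    have h1 := hcN i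
    have h2 := hcs i
    have h3 : g i * c i + g (N + i) * c (N + i) = |c i| := by
      rw [← h2, h1]; simp only [hg, hcN, Real.sign_neg]; ring
    have h4 : 2 * δ - θ + 2 * δ * (i:ℝ) = 2 * δ * (i + 1) - θ := by ring
    rw [h4]
    exact h3.ge

lemma aux_upper (δ : ℝ) (N : ℕ) (h : 2 * δ * N = π) (hδ : 0 < δ)
    (hs : 0 < sin δ) (q : Fin (N + N) → ℝ) (hq : ∀ i, 0 ≤ q i ∧ q i ≤ 1) :
    ∑ i, q i * sin (2 * δ * ((i : ℕ) + 1)) ≤ cos δ / sin δ := by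
  have e := aux_double (fun i => max (sin (2 * δ * (i + 1))) 0) N
  calc _ ≤ ∑ i : Fin (N + N), max (sin (2 * δ * ((i : ℕ) + 1))) 0 := by
        refine Finset.sum_le_sum fun i _ => ?_
        obtain ⟨h0, h1⟩ := hq i
        have := le_max_left (sin (2 * δ * ((i : ℕ) + 1))) 0
        have := le_max_right (sin (2 * δ * ((i : ℕ) + 1))) 0
        nlinarith
      _ = _ := e
      _ ≤ ∑ i ∈ Finset.range N, cos (2 * δ - π / 2 + 2 * δ * i) := by
        refine Finset.sum_le_sum fun i hi => ?_
        have hi' : (i : ℝ) + 1 ≤ N := by exact_mod_cast Finset.mem_range.1 hi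
        have hp : 0 ≤ sin (2 * δ * (i + 1)) := by
          apply sin_nonneg_of_nonneg_of_le_pi (by positivity)
          rw [← h]; gcongr
        have e1 : 2 * δ * (((N + i : ℕ) : ℝ) + 1) = 2 * δ * (i + 1) + π := by
          rw [← h]; push_cast; ring
        rw [e1, sin_add_pi, max_eq_left hp, max_eq_right (by linarith), add_zero,
          ← cos_sub_pi_div_two]
        apply le_of_eq; congr 1; ring
      _ = _ := by
        rw [aux_sum δ _ N h hs]
        congr 1
        rw [← sin_neg, ← sin_pi_div_two_sub]
        congr 1; ring


/-- For even `n ≥ 4`, the inradius of the compatible region of the rotationally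
symmetric planar POVM with uniform weights `1/n` equals `(2/n)·cot(π/n)`: the closed
ball of this radius centered at the origin is contained in the region, and no closed
ball of larger radius is. -/
theorem rot_planar_inradius_even (n : ℕ) (hn : 4 ≤ n) (heven : Even n) :
    (Metric.closedBall (0 : EuclideanSpace ℝ (Fin 2))
        ((2 / n) * (Real.cos (π / n) / Real.sin (π / n))) ⊆
      compatRegion (fun _ => (1 / n : ℝ)) (rotVec n)) ∧
    ∀ r : ℝ,
      (2 / n) * (Real.cos (π / n) / Real.sin (π / n)) < r →
      ¬ Metric.closedBall (0 : EuclideanSpace ℝ (Fin 2)) r ⊆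
          compatRegion (fun _ => (1 / n : ℝ)) (rotVec n) := by
  obtain ⟨N, rfl⟩ := heven
  have hN : 0 < N := by omega
  have hNR : (2:ℝ) ≤ N := by exact_mod_cast (by omega : 2 ≤ N)
  set δ : ℝ := π / ((N + N : ℕ) : ℝ) with hδdef
  have hpi := Real.pi_pos
  have hn0 : (0:ℝ) < ((N + N : ℕ) : ℝ) := by push_cast; linarith
  have h : 2 * δ * N = π := by rw [hδdef]; push_cast; field_simp; ring
  have hδ : 0 < δ := by positivity
  have hδ2 : δ ≤ π / 2 := by nlinarith
  have hs : 0 < sin δ := sin_pos_of_pos_of_lt_pi hδ (by linarith)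
  have hcos : 0 ≤ cos δ := cos_nonneg_of_neg_pi_div_two_le_of_le (by linarith) hδ2
  have hang : ∀ i : ℕ, 2 * π * ((i : ℝ) + 1) / ((N + N : ℕ) : ℝ) = 2 * δ * (i + 1) := by
    intro i; rw [hδdef]; ring
  have hv0 : ∀ i, rotVec (N + N) i 0 = cos (2 * δ * ((i : ℕ) + 1)) := by
    intro i; rw [← hang]; simp [rotVec]
  have hv1 : ∀ i, rotVec (N + N) i 1 = sin (2 * δ * ((i : ℕ) + 1)) := by
    intro i; rw [← hang]; simp [rotVec]
  constructor
  · intro x hx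
    by_contra hxm
    obtain ⟨f, u, hf, hu⟩ := geometric_hahn_banach_closed_point
      (aux_convex _ _) (aux_closed _ _) hxm
    set a := f (EuclideanSpace.single 0 1) with ha
    set b := f (EuclideanSpace.single 1 1) with hb
    have hfx : ∀ y : EuclideanSpace ℝ (Fin 2), f y = a * y 0 + b * y 1 := by
      intro y
      have : y = y 0 • EuclideanSpace.single 0 1 + y 1 • EuclideanSpace.single 1 1 := by
        ext j; fin_cases j <;> simp
      conv_lhs => rw [this]
      rw [map_add, map_smul, map_smul, smul_eq_mul, smul_eq_mul]
      ring
    set z : ℂ := ⟨a, b⟩ with hz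
    have hza : a = ‖z‖ * cos z.arg := (Complex.norm_mul_cos_arg z).symm
    have hzb : b = ‖z‖ * sin z.arg := (Complex.norm_mul_sin_arg z).symm
    obtain ⟨q, hq, hqs, hqc⟩ := aux_support δ z.arg N hN h hδ (by linarith) hs
    have hmem : (∑ i, (2 * (q i * (1 / ((N + N : ℕ) : ℝ)))) • rotVec (N + N) i) ∈
        compatRegion (fun _ => (1 / ((N + N : ℕ) : ℝ))) (rotVec (N + N)) := by
      refine ⟨q, hq, ?_, rfl⟩
      rw [← Finset.sum_mul, hqs]; push_cast; field_simp; ring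
    have h1 := hf _ hmem
    have h2 : f (∑ i, (2 * (q i * (1 / ((N + N : ℕ) : ℝ)))) • rotVec (N + N) i)
        = ‖z‖ * (2 / ((N + N : ℕ) : ℝ)) *
          ∑ i, q i * cos (2 * δ * ((i : ℕ) + 1) - z.arg) := by
      rw [map_sum, Finset.mul_sum]
      refine Finset.sum_congr rfl fun i _ => ?_
      rw [map_smul, hfx, hv0, hv1, hza, hzb, cos_sub, smul_eq_mul]
      ring
    have h3 : ‖z‖ * (2 / ((N + N : ℕ) : ℝ)) * (cos δ / sin δ) ≤
        ‖z‖ * (2 / ((N + N : ℕ) : ℝ)) *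
          ∑ i, q i * cos (2 * δ * ((i : ℕ) + 1) - z.arg) := by
      gcongr
    have h4 : f x ≤ ‖z‖ * ‖x‖ := by
      rw [hfx]
      have e1 : ‖z‖ ^ 2 = a ^ 2 + b ^ 2 := by
        rw [← Complex.normSq_eq_norm_sq, Complex.normSq_apply]; ring
      have e2 : ‖x‖ ^ 2 = x 0 ^ 2 + x 1 ^ 2 := by
        rw [EuclideanSpace.real_norm_sq_eq, Fin.sum_univ_two]
      refine (abs_le_of_sq_le_sq' ?_ (by positivity)).2
      rw [mul_pow, e1, e2]
      nlinarith [sq_nonneg (a * x 1 - b * x 0)]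
    have h5 : ‖x‖ ≤ (2 / ((N + N : ℕ) : ℝ)) * (cos δ / sin δ) := by simpa using hx
    have h6 := mul_le_mul_of_nonneg_left h5 (norm_nonneg z)
    rw [h2] at h1
    linarith
  · intro r hr hsub
    have hR : 0 ≤ (2 / ((N + N : ℕ) : ℝ)) * (cos δ / sin δ) := by positivity
    have hmem : (EuclideanSpace.single 1 r : EuclideanSpace ℝ (Fin 2)) ∈
        Metric.closedBall (0 : EuclideanSpace ℝ (Fin 2)) r := by
      simp [abs_of_nonneg (hR.trans hr.le)]
    obtain ⟨q, hq, -, hx⟩ := hsub hmem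
    have h1 := aux_upper δ N h hδ hs q hq
    have h2 : r = (2 / ((N + N : ℕ) : ℝ)) * ∑ i, q i * sin (2 * δ * ((i : ℕ) + 1)) := by
      have := congrArg (fun y : EuclideanSpace ℝ (Fin 2) => y 1) hx
      simp only [PiLp.single_apply, if_true, WithLp.ofLp_sum, Finset.sum_apply, PiLp.smul_apply,
        hv1, smul_eq_mul] at this
      rw [this, Finset.mul_sum]
      refine Finset.sum_congr rfl fun i _ => ?_
      ring
    have h3 := mul_le_mul_of_nonneg_left h1 (by positivity : 0 ≤ 2 / ((N + N : ℕ) : ℝ))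
    linarith
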